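/- arXiv:2309.15479 — 5 statements merged into one kernel-verified Lean document; each statement's English description precedes it below -/
import Mathlib

section
/- Let w > 0 be a real number and let x, y be fixed real numbers. Let b be a random variable uniformly distributed on the interval [0, w]. Then the probability that ⌊(x + b)/w⌋ = ⌊(y + b)/w⌋ equals max(0, 1 − |x − y|/w). -/
open MeasureTheory ProbabilityTheory

/-- For `0 ≤ x < w` and `x ≤ y`, the shifts in `[0, w)` putting `x` and `y` into the same bucket
form a union of two intervals: both points land in bucket `0`, or both land in bucket `1`. -/
lemma setOf_floor_add_div_eq_inter_Ico {w x y : ℝ} (hw : 0 < w) (hx0 : 0 ≤ x) (hxw : x < w)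
    (hxy : x ≤ y) :
    {t | ⌊(x + t) / w⌋ = ⌊(y + t) / w⌋} ∩ Set.Ico 0 w =
      Set.Ico 0 (w - y) ∪ Set.Ico (w - x) (min w (2 * w - y)) := by
  ext t
  simp only [Set.mem_inter_iff, Set.mem_ofPred_eq, Set.mem_Ico, Set.mem_union, lt_min_iff]
  by_cases ht : 0 ≤ t ∧ t < w
  · obtain ⟨ht0, htw⟩ := ht
    rcases lt_or_ge t (w - x) with h | h
    · have hfloor : ⌊(x + t) / w⌋ = 0 := by
        rw [Int.floor_eq_iff, le_div_iff₀ hw, div_lt_iff₀ hw]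
        push_cast
        constructor <;> linarith
      rw [hfloor, eq_comm, Int.floor_eq_iff, le_div_iff₀ hw, div_lt_iff₀ hw]
      push_cast
      grind
    · have hfloor : ⌊(x + t) / w⌋ = 1 := by
        rw [Int.floor_eq_iff, le_div_iff₀ hw, div_lt_iff₀ hw]
        push_cast
        constructor <;> linarith
      rw [hfloor, eq_comm, Int.floor_eq_iff, le_div_iff₀ hw, div_lt_iff₀ hw]
      push_cast
      grind
  · grind

lemma volume_setOf_floor_add_div_eq_inter_Ico_of_le {w x y : ℝ} (hw : 0 < w) (hxy : x ≤ y) :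
    volume ({t | ⌊(x + t) / w⌋ = ⌊(y + t) / w⌋} ∩ Set.Ico 0 w) =
      ENNReal.ofReal (w - (y - x)) := by
  wlog hx : 0 ≤ x ∧ x < w generalizing x y
  · have hshift (z t : ℝ) : ⌊(z - ⌊x / w⌋ * w + t) / w⌋ = ⌊(z + t) / w⌋ - ⌊x / w⌋ := by
      rw [← Int.floor_sub_intCast]
      congr 1
      field_simp
      ring
    have key := this (x := x - ⌊x / w⌋ * w) (y := y - ⌊x / w⌋ * w) (by linarith)
      ⟨Int.sub_floor_div_mul_nonneg x hw, Int.sub_floor_div_mul_lt x hw⟩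
    simpa only [hshift, sub_left_inj, sub_sub_sub_cancel_right] using key
  obtain ⟨hx0, hxw⟩ := hx
  have hdisj : Disjoint (Set.Ico 0 (w - y)) (Set.Ico (w - x) (min w (2 * w - y))) := by
    rw [Set.disjoint_left]
    intro t h h'
    linarith [h.2, h'.1]
  rw [setOf_floor_add_div_eq_inter_Ico hw hx0 hxw hxy, measure_union hdisj measurableSet_Ico,
    Real.volume_Ico, Real.volume_Ico]
  rcases le_total y w with h | h
  · rw [min_eq_left (by linarith), ← ENNReal.ofReal_add (by linarith) (by linarith)]
    congr 1
    ring
  · rw [min_eq_right (by linarith), ENNReal.ofReal_of_nonpos (by linarith), zero_add]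
    congr 1
    ring

lemma volume_setOf_floor_add_div_eq_inter_Ico {w : ℝ} (hw : 0 < w) (x y : ℝ) :
    volume ({t | ⌊(x + t) / w⌋ = ⌊(y + t) / w⌋} ∩ Set.Ico 0 w) =
      ENNReal.ofReal (w - |x - y|) := by
  rcases le_total x y with h | h
  · rw [volume_setOf_floor_add_div_eq_inter_Ico_of_le hw h, abs_sub_comm,
      abs_of_nonneg (sub_nonneg.2 h)]
  · simp_rw [eq_comm (a := ⌊(x + _) / w⌋)]
    rw [volume_setOf_floor_add_div_eq_inter_Ico_of_le hw h, abs_of_nonneg (sub_nonneg.2 h)]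

/-- Bucket-collision lemma: if `b` is uniform on `[0, w]`, then the probability that
`⌊(x + b)/w⌋ = ⌊(y + b)/w⌋` equals `max 0 (1 - |x - y| / w)`. -/
theorem bucket_collision_prob
    {Ω : Type*} [MeasurableSpace Ω] (P : Measure Ω) [IsProbabilityMeasure P]
    (w x y : ℝ) (hw : 0 < w)
    (b : Ω → ℝ) (hb : Measurable b)
    (hblaw : Measure.map b P = (ENNReal.ofReal w)⁻¹ • volume.restrict (Set.Icc 0 w)) :
    P {ω | ⌊(x + b ω) / w⌋ = ⌊(y + b ω) / w⌋} =
      ENNReal.ofReal (max 0 (1 - |x - y| / w)) := by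
  have hS : MeasurableSet {t : ℝ | ⌊(x + t) / w⌋ = ⌊(y + t) / w⌋} :=
    measurableSet_eq_fun (by fun_prop) (by fun_prop)
  change P (b ⁻¹' {t | ⌊(x + t) / w⌋ = ⌊(y + t) / w⌋}) = _
  rw [← Measure.map_apply hb hS, hblaw, ← restrict_Ico_eq_restrict_Icc, Measure.smul_apply,
    Measure.restrict_apply hS, volume_setOf_floor_add_div_eq_inter_Ico hw, smul_eq_mul,
    ← ENNReal.ofReal_inv_of_pos hw, ← ENNReal.ofReal_mul (inv_nonneg.2 hw.le), max_comm,
    ENNReal.ofReal_max, ENNReal.ofReal_zero, max_eq_left zero_le]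
  congr 1
  field_simp
end

section
/- Let n ≥ 1, let v, u ∈ ℝⁿ with s := ‖v − u‖₂ > 0, and let w > 0. Let a be a random vector in ℝⁿ with i.i.d. standard normal N(0,1) entries, and let b be uniformly distributed on [0, w], independent of a. Then the probability that ⌊(aᵀv + b)/w⌋ = ⌊(aᵀu + b)/w⌋ equals ∫₀^w (2/s) φ(t/s) (1 − t/w) dt, where φ(x) = (1/√(2π)) exp(−x²/2) is the standard normal probability density function. -/
open MeasureTheory ProbabilityTheory

/-- The standard normal probability density function `φ`. -/
noncomputable def stdGaussPDF (x : ℝ) : ℝ :=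
  (Real.sqrt (2 * Real.pi))⁻¹ * Real.exp (-x ^ 2 / 2)

/-- A set of reals invariant under translation by `w` has the same measure in every half-open
interval of length `w`. -/
lemma volume_inter_Ioc_of_periodic {w : ℝ} (hw : 0 < w) {A : Set ℝ} (hA : MeasurableSet A)
    (hper : ∀ x, x + w ∈ A ↔ x ∈ A) (c d : ℝ) :
    volume (A ∩ Set.Ioc c (c + w)) = volume (A ∩ Set.Ioc d (d + w)) := by
  refine (isAddFundamentalDomain_Ioc hw c).measure_set_eq (isAddFundamentalDomain_Ioc hw d) hA ?_
  have hp : Function.Periodic (fun x => x ∈ A) w := fun x => propext (hper x)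
  rintro ⟨g, hg⟩
  obtain ⟨k, rfl⟩ := AddSubgroup.mem_zmultiples_iff.1 hg
  ext x
  have h := hp.zsmul k x
  simp only [Set.mem_preimage, AddSubgroup.mk_vadd, vadd_eq_add]
  rw [add_comm]
  exact iff_of_eq h

lemma measurableSet_floor_eq (w p q : ℝ) :
    MeasurableSet {x : ℝ | ⌊(p + x) / w⌋ = ⌊(q + x) / w⌋} :=
  measurableSet_eq_fun (by fun_prop) (by fun_prop)

lemma volume_floor_eq_of_le {w : ℝ} (hw : 0 < w) {p q : ℝ} (hpq : p ≤ q) :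
    volume ({x : ℝ | ⌊(p + x) / w⌋ = ⌊(q + x) / w⌋} ∩ Set.Icc 0 w) =
      ENNReal.ofReal (w - (q - p)) := by
  have hper : ∀ x, x + w ∈ {x : ℝ | ⌊(p + x) / w⌋ = ⌊(q + x) / w⌋} ↔
      x ∈ {x : ℝ | ⌊(p + x) / w⌋ = ⌊(q + x) / w⌋} := by
    intro x
    have h (r : ℝ) : (r + (x + w)) / w = (r + x) / w + 1 := by field_simp; ring
    simp only [Set.mem_ofPred_eq, h, Int.floor_add_one, add_left_inj]
  have hIco : {x : ℝ | ⌊(p + x) / w⌋ = ⌊(q + x) / w⌋} ∩ Set.Ico (-p) (-p + w) =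
      Set.Ico (-p) (w - q) := by
    ext x
    simp only [Set.mem_inter_iff, Set.mem_ofPred_eq, Set.mem_Ico]
    constructor
    · rintro ⟨h, h1, h2⟩
      have h0 : ⌊(p + x) / w⌋ = 0 := by
        rw [Int.floor_eq_zero_iff, Set.mem_Ico, div_lt_one hw]
        exact ⟨div_nonneg (by linarith) hw.le, by linarith⟩
      rw [h0, eq_comm, Int.floor_eq_zero_iff, Set.mem_Ico, div_lt_one hw] at h
      exact ⟨h1, by linarith [h.2]⟩
    · rintro ⟨h1, h2⟩
      refine ⟨?_, h1, by linarith⟩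
      rw [Int.floor_eq_zero_iff.2, eq_comm, Int.floor_eq_zero_iff]
      · exact ⟨div_nonneg (by linarith) hw.le, (div_lt_one hw).2 (by linarith)⟩
      · exact ⟨div_nonneg (by linarith) hw.le, (div_lt_one hw).2 (by linarith)⟩
  calc _ = volume ({x : ℝ | ⌊(p + x) / w⌋ = ⌊(q + x) / w⌋} ∩ Set.Ioc 0 (0 + w)) := by
        rw [zero_add]
        exact measure_congr ((ae_eq_refl _).inter Ioc_ae_eq_Icc.symm)
    _ = volume ({x : ℝ | ⌊(p + x) / w⌋ = ⌊(q + x) / w⌋} ∩ Set.Ioc (-p) (-p + w)) :=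
        volume_inter_Ioc_of_periodic hw (measurableSet_floor_eq w p q) hper _ _
    _ = volume ({x : ℝ | ⌊(p + x) / w⌋ = ⌊(q + x) / w⌋} ∩ Set.Ico (-p) (-p + w)) :=
        measure_congr ((ae_eq_refl _).inter Ico_ae_eq_Ioc.symm)
    _ = _ := by
        rw [hIco, Real.volume_Ico]
        congr 1
        ring

/-- For a uniform offset on `[0, w]`, two points at distance `d` share a bucket with probability
`max 0 (1 - d / w)`. -/
lemma uniform_floor_eq {w : ℝ} (hw : 0 < w) (p q : ℝ) :
    ((ENNReal.ofReal w)⁻¹ • volume.restrict (Set.Icc 0 w))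
      {x : ℝ | ⌊(p + x) / w⌋ = ⌊(q + x) / w⌋} = ENNReal.ofReal (1 - |p - q| / w) := by
  have key : volume ({x : ℝ | ⌊(p + x) / w⌋ = ⌊(q + x) / w⌋} ∩ Set.Icc 0 w) =
      ENNReal.ofReal (w - |p - q|) := by
    rcases le_total p q with h | h
    · rw [volume_floor_eq_of_le hw h, abs_sub_comm, abs_of_nonneg (sub_nonneg.2 h)]
    · simp_rw [eq_comm (a := ⌊(p + _) / w⌋)]
      rw [volume_floor_eq_of_le hw h, abs_of_nonneg (sub_nonneg.2 h)]
  rw [Measure.smul_apply, Measure.restrict_apply (measurableSet_floor_eq w p q), key, smul_eq_mul,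
    ← ENNReal.ofReal_inv_of_pos hw, ← ENNReal.ofReal_mul (inv_nonneg.2 hw.le)]
  congr 1
  field_simp

/-- A linear form of a standard Gaussian vector is Gaussian with variance the squared norm of its
coefficient vector. -/
lemma map_pi_gaussianReal_sum_mul {ι : Type*} [Fintype ι] (c : EuclideanSpace ℝ ι) :
    (Measure.pi fun _ : ι => gaussianReal 0 1).map (fun x => ∑ i, x i * c i) =
      gaussianReal 0 (‖c‖₊ ^ 2) := by
  have hcomp : (fun x : ι → ℝ => ∑ i, x i * c i) =
      (fun y : EuclideanSpace ℝ ι => inner ℝ y c) ∘ WithLp.toLp 2 := by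
    ext x
    simp [PiLp.inner_apply, mul_comm]
  rw [hcomp, ← Measure.map_map (by fun_prop) (by fun_prop), map_pi_eq_stdGaussian]
  apply Measure.ext_of_charFun
  ext t
  rw [charFun_apply_real, integral_map (by fun_prop) (by fun_prop), charFun_gaussianReal]
  have h := charFun_stdGaussian (E := EuclideanSpace ℝ ι) (t • c)
  rw [charFun_apply] at h
  simp only [real_inner_smul_right, Complex.ofReal_mul] at h
  rw [h, norm_smul]
  congr 1
  have ht : ((|t| : ℝ) : ℂ) ^ 2 = (t : ℂ) ^ 2 := by
    rw [← Complex.ofReal_pow, sq_abs, Complex.ofReal_pow]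
  simp only [Real.norm_eq_abs, Complex.ofReal_mul, mul_pow, ht]
  push_cast
  simp
  ring

lemma gaussianPDFReal_zero_sq {s : ℝ} {r : NNReal} (hr : (r : ℝ) = s) (hs : 0 < s) (t : ℝ) :
    gaussianPDFReal 0 (r ^ 2) t = s⁻¹ * stdGaussPDF (t / s) := by
  rw [gaussianPDFReal, stdGaussPDF, NNReal.coe_pow, hr, Real.sqrt_mul (by positivity),
    Real.sqrt_sq hs.le, mul_inv, sub_zero, mul_comm (Real.sqrt _)⁻¹, mul_assoc]
  congr 3
  field_simp

/-- The expected triangular kernel of a centred Gaussian with standard deviation `s`. -/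
lemma lintegral_gaussianReal_triangle {s w : ℝ} {r : NNReal} (hr : (r : ℝ) = s) (hs : 0 < s)
    (hw : 0 < w) :
    ∫⁻ t, ENNReal.ofReal (1 - |t| / w) ∂(gaussianReal 0 (r ^ 2)) =
      ENNReal.ofReal (∫ t in (0:ℝ)..w, (2 / s) * stdGaussPDF (t / s) * (1 - t / w)) := by
  have hr0 : r ^ 2 ≠ 0 := by
    refine pow_ne_zero _ fun h => ?_
    simp [h] at hr
    exact hs.ne hr
  set g : ℝ → ℝ := gaussianPDFReal 0 (r ^ 2) with hg
  have heven (t : ℝ) : g |t| = g t := by simp [hg, gaussianPDFReal]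
  have hint : Integrable fun t => g t * max (1 - |t| / w) 0 := by
    refine (integrable_gaussianPDFReal 0 (r ^ 2)).mul_bdd (c := 1) (by fun_prop)
      (.of_forall fun t => ?_)
    rw [Real.norm_of_nonneg (le_max_right _ _)]
    exact max_le (by linarith [div_nonneg (abs_nonneg t) hw.le]) zero_le_one
  rw [gaussianReal_of_var_ne_zero _ hr0, lintegral_withDensity_eq_lintegral_mul _
    (measurable_gaussianPDF _ _) (by fun_prop)]
  calc _ = ∫⁻ t, ENNReal.ofReal (g t * max (1 - |t| / w) 0) := by
        refine lintegral_congr fun t => ?_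
        rw [Pi.mul_apply, gaussianPDF, ENNReal.ofReal_mul (gaussianPDFReal_nonneg _ _ _)]
        simp
    _ = ENNReal.ofReal (∫ t, g t * max (1 - |t| / w) 0) :=
        (ofReal_integral_eq_lintegral_ofReal hint (.of_forall fun t =>
          mul_nonneg (gaussianPDFReal_nonneg _ _ _) (le_max_right _ _))).symm
    _ = _ := by
        congr 1
        have habs := integral_comp_abs (f := fun t => g t * max (1 - t / w) 0)
        simp only [heven] at habs
        rw [habs, intervalIntegral.integral_of_le hw.le, ← integral_const_mul]
        symm
        rw [setIntegral_congr_fun (g := fun t => 2 * (g t * max (1 - t / w) 0)) measurableSet_Ioc]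
        · refine (setIntegral_eq_of_subset_of_forall_sdiff_eq_zero measurableSet_Ioi
            Set.Ioc_subset_Ioi_self fun t ht => ?_).symm
          have hwt : w ≤ t := by
            by_contra! h
            exact ht.2 ⟨ht.1, h.le⟩
          rw [max_eq_right (sub_nonpos.2 ((one_le_div hw).2 hwt)), mul_zero, mul_zero]
        · intro t ht
          simp only [hg]
          rw [gaussianPDFReal_zero_sq hr hs, max_eq_left (sub_nonneg.2 ((div_le_one hw).2 ht.2))]
          ring

/-- Collision probability of E2LSH: for `a` with i.i.d. `N(0,1)` entries and `b` uniform on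
`[0, w]` independent of `a`, the probability that `⌊(aᵀv + b)/w⌋ = ⌊(aᵀu + b)/w⌋` equals
`∫₀^w (2/s) φ(t/s) (1 - t/w) dt` with `s = ‖v - u‖₂`. -/
theorem e2lsh_collision_prob
    {Ω : Type*} [MeasurableSpace Ω] (P : Measure Ω) [IsProbabilityMeasure P]
    (n : ℕ) (hn : 1 ≤ n) (v u : EuclideanSpace ℝ (Fin n)) (s : ℝ)
    (hs : s = ‖v - u‖) (hs0 : 0 < s) (w : ℝ) (hw : 0 < w)
    (a : Ω → (Fin n → ℝ)) (b : Ω → ℝ) (ha : Measurable a) (hb : Measurable b)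
    (halaw : Measure.map a P = Measure.pi fun _ : Fin n => gaussianReal 0 1)
    (hblaw : Measure.map b P = (ENNReal.ofReal w)⁻¹ • volume.restrict (Set.Icc 0 w))
    (hindep : IndepFun a b P) :
    P {ω | ⌊((∑ i, a ω i * v i) + b ω) / w⌋ = ⌊((∑ i, a ω i * u i) + b ω) / w⌋} =
      ENNReal.ofReal (∫ t in (0:ℝ)..w, (2 / s) * stdGaussPDF (t / s) * (1 - t / w)) := by
  have hS : MeasurableSet {z : (Fin n → ℝ) × ℝ |
      ⌊((∑ i, z.1 i * v i) + z.2) / w⌋ = ⌊((∑ i, z.1 i * u i) + z.2) / w⌋} :=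
    measurableSet_eq_fun (by fun_prop) (by fun_prop)
  have : IsProbabilityMeasure (P.map b) := Measure.isProbabilityMeasure_map hb.aemeasurable
  have hsub (x : Fin n → ℝ) :
      (∑ i, x i * v i) - ∑ i, x i * u i = ∑ i, x i * (v - u) i := by
    simp [← Finset.sum_sub_distrib, mul_sub]
  calc _ = P.map (fun ω => (a ω, b ω)) {z : (Fin n → ℝ) × ℝ |
        ⌊((∑ i, z.1 i * v i) + z.2) / w⌋ = ⌊((∑ i, z.1 i * u i) + z.2) / w⌋} :=
        (Measure.map_apply (ha.prodMk hb) hS).symm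
    _ = ∫⁻ x, P.map b {y | ⌊((∑ i, x i * v i) + y) / w⌋ = ⌊((∑ i, x i * u i) + y) / w⌋}
          ∂(P.map a) := by
        rw [(indepFun_iff_map_prod_eq_prod_map_map ha.aemeasurable hb.aemeasurable).1 hindep,
          Measure.prod_apply hS]
        rfl
    _ = ∫⁻ x, ENNReal.ofReal (1 - |∑ i, x i * (v - u) i| / w)
          ∂(Measure.pi fun _ : Fin n => gaussianReal 0 1) := by
        rw [hblaw, halaw]
        refine lintegral_congr fun x => ?_
        rw [uniform_floor_eq hw, hsub]
    _ = ∫⁻ t, ENNReal.ofReal (1 - |t| / w) ∂(gaussianReal 0 (‖v - u‖₊ ^ 2)) := by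
        rw [← map_pi_gaussianReal_sum_mul, lintegral_map (by fun_prop) (by fun_prop)]
    _ = _ := lintegral_gaussianReal_triangle (by rw [hs, coe_nnnorm]) hs0 hw
end

section
/- Fix w > 0 and define p(s) = ∫₀^w (2/s) φ(t/s) (1 − t/w) dt for s > 0, where φ(x) = (1/√(2π)) exp(−x²/2) is the standard normal probability density function. Then p is a strictly monotonically decreasing function of s on (0, ∞). -/
open MeasureTheory

theorem stdGaussPDF_pos (x : ℝ) : 0 < stdGaussPDF x := by
  unfold stdGaussPDF
  positivity

theorem continuous_stdGaussPDF : Continuous stdGaussPDF := by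
  unfold stdGaussPDF
  fun_prop

theorem integral_e2lsh_eq_rescaled (w : ℝ) {s : ℝ} (hs : s ≠ 0) :
    ∫ t in (0:ℝ)..w, (2 / s) * stdGaussPDF (t / s) * (1 - t / w) =
      ∫ x in (0:ℝ)..(w / s), 2 * stdGaussPDF x * (1 - s * x / w) := by
  have h := intervalIntegral.integral_comp_div (a := 0) (b := w)
    (fun x => 2 / s * stdGaussPDF x * (1 - s * x / w)) hs
  simp only [mul_div_cancel₀ _ hs, zero_div, smul_eq_mul] at h
  rw [h, ← intervalIntegral.integral_const_mul]
  congr 1 with x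
  field_simp

/-- The E2LSH collision probability `p(s) = ∫₀^w (2/s) φ(t/s) (1 - t/w) dt` is a strictly
monotonically decreasing function of `s` on `(0, ∞)`. -/
theorem e2lsh_collision_prob_strictAnti (w : ℝ) (hw : 0 < w) :
    StrictAntiOn
      (fun s : ℝ => ∫ t in (0:ℝ)..w, (2 / s) * stdGaussPDF (t / s) * (1 - t / w))
      (Set.Ioi 0) := by
  intro r hr s hs hrs
  rw [Set.mem_Ioi] at hr hs
  simp only [integral_e2lsh_eq_rescaled w hr.ne', integral_e2lsh_eq_rescaled w hs.ne']
  have hcont (c : ℝ) : Continuous fun x => 2 * stdGaussPDF x * (1 - c * x / w) := by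
    have := continuous_stdGaussPDF
    fun_prop
  have hws : 0 < w / s := div_pos hw hs
  have hlt {x : ℝ} (hx : 0 < x) :
      2 * stdGaussPDF x * (1 - s * x / w) < 2 * stdGaussPDF x * (1 - r * x / w) := by
    have := stdGaussPDF_pos x
    gcongr
  have hhead : ∫ x in (0:ℝ)..(w / s), 2 * stdGaussPDF x * (1 - s * x / w) <
      ∫ x in (0:ℝ)..(w / s), 2 * stdGaussPDF x * (1 - r * x / w) :=
    intervalIntegral.integral_lt_integral_of_continuousOn_of_le_of_exists_lt hws
      (hcont s).continuousOn (hcont r).continuousOn (fun x hx => (hlt hx.1).le)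
      ⟨w / s, Set.right_mem_Icc.2 hws.le, hlt hws⟩
  have htail : 0 ≤ ∫ x in (w / s)..(w / r), 2 * stdGaussPDF x * (1 - r * x / w) := by
    refine intervalIntegral.integral_nonneg (by gcongr) fun x hx => ?_
    have hx' : r * x / w ≤ 1 := by
      rw [div_le_one hw, mul_comm]
      exact (le_div_iff₀ hr).1 hx.2
    exact mul_nonneg (mul_pos two_pos (stdGaussPDF_pos x)).le (sub_nonneg.2 hx')
  rw [← intervalIntegral.integral_add_adjacent_intervals
    ((hcont r).intervalIntegrable 0 (w / s)) ((hcont r).intervalIntegrable (w / s) (w / r))]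
  linarith
end

section
/- Let μ̃ ∈ ℝ and σ̃ > 0. Let T be a real random variable with the truncated normal density ψ(x; μ̃, σ̃², 0, ∞), i.e., with density x ↦ φ((x−μ̃)/σ̃) / (σ̃ (1 − Φ(−μ̃/σ̃))) for x > 0 and 0 for x ≤ 0, let S = √T, and let X be a standard normal random variable independent of S. Then for every real x, E[exp(i x S X)] = [1 / (2(1 − Φ(−μ̃/σ̃)))] · exp((1/8) x⁴ σ̃² − (1/2) μ̃ x²) · erfc((½ x² σ̃² − μ̃) / (√2 σ̃)). -/
open MeasureTheory ProbabilityTheory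
open scoped ENNReal

/-- The standard normal cumulative distribution function `Φ`. -/
noncomputable def stdGaussCDF (x : ℝ) : ℝ :=
  ∫ t in Set.Iic x, stdGaussPDF t

/-- The complementary error function `erfc`. -/
noncomputable def erfc (t : ℝ) : ℝ :=
  (2 / Real.sqrt Real.pi) * ∫ x in Set.Ioi t, Real.exp (-x ^ 2)

/-- The density of the normal distribution `N(μ̃, σ̃²)` truncated to `(0, ∞)`. -/
noncomputable def truncNormalPDF (μt σt : ℝ) (x : ℝ) : ℝ :=
  if 0 < x then stdGaussPDF ((x - μt) / σt) / (σt * (1 - stdGaussCDF (-μt / σt))) else 0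

theorem stdGaussPDF_eq_gaussianPDFReal : stdGaussPDF = gaussianPDFReal 0 1 := by
  ext x
  simp [stdGaussPDF, gaussianPDFReal]

theorem stdGaussPDF_nonneg (x : ℝ) : 0 ≤ stdGaussPDF x := by
  rw [stdGaussPDF]
  positivity

theorem stdGaussCDF_le_one (x : ℝ) : stdGaussCDF x ≤ 1 := by
  rw [stdGaussCDF, stdGaussPDF_eq_gaussianPDFReal,
    ← integral_gaussianPDFReal_eq_one 0 (one_ne_zero : (1 : NNReal) ≠ 0)]
  exact setIntegral_le_integral (integrable_gaussianPDFReal 0 1)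
    (ae_of_all _ (gaussianPDFReal_nonneg 0 1))

theorem truncNormalPDF_nonneg (μt : ℝ) {σt : ℝ} (hσt : 0 < σt) (x : ℝ) :
    0 ≤ truncNormalPDF μt σt x := by
  rw [truncNormalPDF]
  split_ifs
  · exact div_nonneg (stdGaussPDF_nonneg _)
      (mul_nonneg hσt.le (sub_nonneg.2 (stdGaussCDF_le_one _)))
  · exact le_rfl

theorem measurable_truncNormalPDF (μt σt : ℝ) : Measurable (truncNormalPDF μt σt) := by
  unfold truncNormalPDF stdGaussPDF
  exact Measurable.ite measurableSet_Ioi (by fun_prop) measurable_const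

/-- Affine change of variables on a right half-line. -/
theorem integral_comp_mul_add_Ioi {E : Type*} [NormedAddCommGroup E] [NormedSpace ℝ E]
    (g : ℝ → E) (a c : ℝ) {b : ℝ} (hb : 0 < b) :
    ∫ t in Set.Ioi a, g (b * t + c) = b⁻¹ • ∫ t in Set.Ioi (b * a + c), g t := by
  rw [integral_comp_mul_left_Ioi (fun t => g (t + c)) a hb,
    ← (measurePreserving_add_right volume c).setIntegral_preimage_emb
      (measurableEmbedding_addRight c) g (Set.Ioi (b * a + c))]
  simp

/-- Characteristic function of a standard Gaussian scaled by an independent random factor. -/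
theorem integral_cexp_mul_gaussian_of_indepFun {Ω : Type*} [MeasurableSpace Ω] {P : Measure Ω}
    [IsProbabilityMeasure P] {S X : Ω → ℝ} (hS : Measurable S) (hX : Measurable X)
    (hXlaw : Measure.map X P = gaussianReal 0 1) (hindep : IndepFun S X P) (x : ℝ) :
    ∫ ω, Complex.exp ((x : ℂ) * S ω * X ω * Complex.I) ∂P =
      ((∫ ω, Real.exp (-(x * S ω) ^ 2 / 2) ∂P : ℝ) : ℂ) := by
  have : IsProbabilityMeasure (Measure.map S P) :=
    Measure.isProbabilityMeasure_map hS.aemeasurable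
  set f : ℝ × ℝ → ℂ := fun p => Complex.exp ((x : ℂ) * p.1 * p.2 * Complex.I) with hf
  have hfm : Measurable f := by fun_prop
  have hfint : Integrable f ((Measure.map S P).prod (gaussianReal 0 1)) := by
    refine Integrable.of_bound hfm.aestronglyMeasurable 1 (ae_of_all _ fun p => ?_)
    have := Complex.norm_exp_ofReal_mul_I (x * p.1 * p.2)
    push_cast at this
    exact this.le
  calc ∫ ω, Complex.exp ((x : ℂ) * S ω * X ω * Complex.I) ∂P
      = ∫ p, f p ∂(Measure.map (fun ω => (S ω, X ω)) P) :=
        (integral_map (hS.prodMk hX).aemeasurable hfm.aestronglyMeasurable).symm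
    _ = ∫ s, ∫ y, f (s, y) ∂(gaussianReal 0 1) ∂(Measure.map S P) := by
        rw [(indepFun_iff_map_prod_eq_prod_map_map hS.aemeasurable hX.aemeasurable).1 hindep,
          hXlaw, integral_prod f hfint]
    _ = ∫ s, ((Real.exp (-(x * s) ^ 2 / 2) : ℝ) : ℂ) ∂(Measure.map S P) := by
        congr with s
        have h := charFun_gaussianReal (μ := 0) (v := 1) (x * s)
        rw [charFun_apply_real] at h
        simp only [hf]
        push_cast at h ⊢
        rw [h]
        congr 1
        simp
        ring
    _ = _ := by
        rw [integral_complex_ofReal,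
          integral_map hS.aemeasurable (by fun_prop)]

/-- Laplace transform of the truncated normal density. -/
theorem integral_truncNormalPDF_mul_exp (μt : ℝ) {σt : ℝ} (hσt : 0 < σt) (x : ℝ) :
    ∫ t in Set.Ioi 0, truncNormalPDF μt σt t * Real.exp (-x ^ 2 * t / 2) =
      1 / (2 * (1 - stdGaussCDF (-μt / σt))) *
        Real.exp ((1/8) * x ^ 4 * σt ^ 2 - (1/2) * μt * x ^ 2) *
        erfc (((1/2) * x ^ 2 * σt ^ 2 - μt) / (Real.sqrt 2 * σt)) := by
  have hsq : Real.sqrt 2 ^ 2 = 2 := Real.sq_sqrt (by norm_num)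
  set K := 1 - stdGaussCDF (-μt / σt)
  set d := ((1/2) * x ^ 2 * σt ^ 2 - μt) / (Real.sqrt 2 * σt) with hd
  set E := Real.exp ((1/8) * x ^ 4 * σt ^ 2 - (1/2) * μt * x ^ 2) with hE
  have hpt : ∀ t ∈ Set.Ioi (0 : ℝ), truncNormalPDF μt σt t * Real.exp (-x ^ 2 * t / 2) =
      ((Real.sqrt (2 * Real.pi))⁻¹ / (σt * K) * E) *
        Real.exp (-((Real.sqrt 2 * σt)⁻¹ * t + d) ^ 2) := by
    intro t ht
    have hexp : Real.exp (-((t - μt) / σt) ^ 2 / 2) * Real.exp (-x ^ 2 * t / 2) =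
        E * Real.exp (-((Real.sqrt 2 * σt)⁻¹ * t + d) ^ 2) := by
      have hsum : (Real.sqrt 2 * σt)⁻¹ * t + d =
          (t + (1/2) * x ^ 2 * σt ^ 2 - μt) / (Real.sqrt 2 * σt) := by
        rw [hd]
        ring
      rw [hE, ← Real.exp_add, ← Real.exp_add, hsum, div_pow _ (Real.sqrt 2 * σt), mul_pow, hsq]
      congr 1
      field_simp
      ring
    rw [truncNormalPDF, if_pos (Set.mem_Ioi.1 ht), stdGaussPDF]
    linear_combination ((Real.sqrt (2 * Real.pi))⁻¹ / (σt * K)) * hexp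
  rw [setIntegral_congr_fun measurableSet_Ioi hpt, integral_const_mul,
    integral_comp_mul_add_Ioi (fun u => Real.exp (-u ^ 2)) 0 d (by positivity), erfc,
    mul_zero, zero_add, inv_inv, smul_eq_mul, Real.sqrt_mul (by norm_num)]
  have hcoef : (Real.sqrt 2 * Real.sqrt Real.pi)⁻¹ / (σt * K) * (Real.sqrt 2 * σt) =
      1 / (2 * K) * (2 / Real.sqrt Real.pi) := by
    field_simp
  linear_combination (E * ∫ u in Set.Ioi d, Real.exp (-u ^ 2)) * hcoef

/-- Characteristic function of `S X` where `S = √T`, `T` follows the normal distribution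
`N(μ̃, σ̃²)` truncated to `(0, ∞)`, and `X` is standard normal independent of `S`. -/
theorem charFun_sqrtTruncNormal_mul_gaussian
    {Ω : Type*} [MeasurableSpace Ω] (P : Measure Ω) [IsProbabilityMeasure P]
    (μt σt : ℝ) (hσt : 0 < σt)
    (T S X : Ω → ℝ) (hT : Measurable T) (hX : Measurable X)
    (hTlaw : Measure.map T P =
      volume.withDensity (fun x => ENNReal.ofReal (truncNormalPDF μt σt x)))
    (hS : S = fun ω => Real.sqrt (T ω))
    (hXlaw : Measure.map X P = gaussianReal 0 1)
    (hindep : IndepFun S X P) (x : ℝ) :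
    ∫ ω, Complex.exp ((x : ℂ) * S ω * X ω * Complex.I) ∂P =
      ((1 / (2 * (1 - stdGaussCDF (-μt / σt))) *
          Real.exp ((1/8) * x ^ 4 * σt ^ 2 - (1/2) * μt * x ^ 2) *
          erfc (((1/2) * x ^ 2 * σt ^ 2 - μt) / (Real.sqrt 2 * σt)) : ℝ) : ℂ) := by
  subst hS
  rw [integral_cexp_mul_gaussian_of_indepFun hT.sqrt hX hXlaw hindep x,
    ← integral_truncNormalPDF_mul_exp μt hσt x]
  congr 1
  have hmap : ∫ ω, Real.exp (-(x * Real.sqrt (T ω)) ^ 2 / 2) ∂P =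
      ∫ t, Real.exp (-(x * Real.sqrt t) ^ 2 / 2) ∂(Measure.map T P) :=
    (integral_map (f := fun t => Real.exp (-(x * Real.sqrt t) ^ 2 / 2)) hT.aemeasurable
      (by fun_prop)).symm
  rw [hmap, hTlaw, integral_withDensity_eq_integral_toReal_smul
    (measurable_truncNormalPDF μt σt).ennreal_ofReal (ae_of_all _ fun _ => ENNReal.ofReal_lt_top),
    ← integral_indicator measurableSet_Ioi]
  congr with t
  rw [ENNReal.toReal_ofReal (truncNormalPDF_nonneg μt hσt t), smul_eq_mul]
  by_cases ht : 0 < t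
  · rw [Set.indicator_of_mem (Set.mem_Ioi.2 ht), mul_pow, Real.sq_sqrt ht.le, neg_mul]
  · rw [Set.indicator_of_notMem (by simpa using ht), truncNormalPDF, if_neg ht, zero_mul]
end

section
/- Let a > 0, b > 0 and C > 0 be fixed real constants, and let (x_m)_{m ≥ 1} be any sequence of real numbers with |x_m| ≤ C·m^{−1/2} for all m. Then lim_{m → ∞} exp(b² m x_m⁴) · erfc(b √m x_m² − a √m) / (2 − erfc(a √m)) = 1. -/
open MeasureTheory

open Filter Topology

theorem integrable_exp_neg_sq : Integrable fun u : ℝ => Real.exp (-u ^ 2) := by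
  simpa using integrable_exp_neg_mul_sq (b := 1) one_pos

theorem integral_exp_neg_sq : ∫ u : ℝ, Real.exp (-u ^ 2) = Real.sqrt Real.pi := by
  simpa using integral_gaussian 1

theorem tendsto_erfc_atBot : Tendsto erfc atBot (𝓝 2) := by
  have h := ((aecover_Ioi (μ := volume) (tendsto_id (α := ℝ) (x := atBot))
    ).integral_tendsto_of_countably_generated integrable_exp_neg_sq).const_mul
      (2 / Real.sqrt Real.pi)
  rwa [integral_exp_neg_sq, div_mul_cancel₀ _ (Real.sqrt_pos.2 Real.pi_pos).ne'] at h

theorem tendsto_erfc_atTop : Tendsto erfc atTop (𝓝 0) := by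
  have h := (((aecover_Iic (μ := volume) (tendsto_id (α := ℝ) (x := atTop))
    ).integral_tendsto_of_countably_generated integrable_exp_neg_sq).const_sub
      (∫ u : ℝ, Real.exp (-u ^ 2))).const_mul (2 / Real.sqrt Real.pi)
  rw [sub_self, mul_zero] at h
  refine h.congr fun t => ?_
  have key := intervalIntegral.integral_Iic_add_Ioi (b := t) (μ := volume)
    integrable_exp_neg_sq.integrableOn integrable_exp_neg_sq.integrableOn
  rw [erfc, ← key, id, add_sub_cancel_left]

/-- Core analytic limit behind the asymptotic equivalence of FastLSH and E2LSH: for any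
sequence `x_m` with `|x_m| ≤ C m^{-1/2}`,
`exp(b² m x_m⁴) · erfc(b √m x_m² - a √m) / (2 - erfc(a √m)) → 1` as `m → ∞`. -/
theorem fastlsh_charFun_ratio_tendsto_one
    (a b C : ℝ) (ha : 0 < a) (hb : 0 < b) (hC : 0 < C)
    (x : ℕ → ℝ) (hx : ∀ m : ℕ, 1 ≤ m → |x m| ≤ C / Real.sqrt m) :
    Filter.Tendsto
      (fun m : ℕ =>
        Real.exp (b ^ 2 * m * x m ^ 4) *
          erfc (b * Real.sqrt m * x m ^ 2 - a * Real.sqrt m) /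
          (2 - erfc (a * Real.sqrt m)))
      Filter.atTop (nhds 1) := by
  have hsqrt : Tendsto (fun m : ℕ => Real.sqrt m) atTop atTop :=
    Real.tendsto_sqrt_atTop.comp tendsto_natCast_atTop_atTop
  have hbound : ∀ m : ℕ, 1 ≤ m → Real.sqrt m * x m ^ 2 ≤ C ^ 2 / Real.sqrt m := by
    intro m hm
    have hs : 0 < Real.sqrt m := Real.sqrt_pos.2 (by exact_mod_cast hm)
    calc Real.sqrt m * x m ^ 2 = Real.sqrt m * |x m| ^ 2 := by rw [sq_abs]
      _ ≤ Real.sqrt m * (C / Real.sqrt m) ^ 2 := by gcongr; exact hx m hm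
      _ = C ^ 2 / Real.sqrt m := by field_simp
  have hsmall : Tendsto (fun m : ℕ => b * Real.sqrt m * x m ^ 2) atTop (𝓝 0) := by
    have h : Tendsto (fun m : ℕ => Real.sqrt m * x m ^ 2) atTop (𝓝 0) :=
      squeeze_zero' (Eventually.of_forall fun m => by positivity)
        ((eventually_ge_atTop 1).mono hbound) (hsqrt.const_div_atTop (C ^ 2))
    simpa [mul_assoc] using h.const_mul b
  have hexp : Tendsto (fun m : ℕ => Real.exp (b ^ 2 * m * x m ^ 4)) atTop (𝓝 1) := by
    rw [← Real.exp_zero]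
    refine (Real.continuous_exp.tendsto 0).comp ?_
    have h := hsmall.pow 2
    rw [zero_pow two_ne_zero] at h
    refine h.congr fun m => ?_
    rw [mul_pow, mul_pow, Real.sq_sqrt m.cast_nonneg, ← pow_mul]
  have harg : Tendsto (fun m : ℕ => a * Real.sqrt m) atTop atTop := hsqrt.const_mul_atTop ha
  have hnum := tendsto_erfc_atBot.comp
    (hsmall.add_atBot (tendsto_neg_atTop_atBot.comp harg))
  have hden := (tendsto_erfc_atTop.comp harg).const_sub 2
  have h := (hexp.mul hnum).div hden (by norm_num)
  norm_num at h
  exact h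
end
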